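/- arXiv:2601.03082 — 2 statements merged into one kernel-verified Lean document; each statement's English description precedes it below -/
import Mathlib

section
/- Let n be a positive integer. Let C̃ be the n×n rational matrix with entries C̃_{i,j} = (n+1−i)(n+1−2i) if i = j; C̃_{i,j} = (n+1−i)(1−i) if i = j+1; C̃_{i,j} = (n+1−i)(n−i) if i = j−1; and C̃_{i,j} = 0 otherwise. Then the characteristic polynomial of C̃ equals ∏_{i=1}^{n} (X − i(n−i)); equivalently, for every rational t, det(t·I − C̃) = ∏_{i=1}^{n} (t − i(n−i)). -/
open Polynomial

/-- The change-of-basis matrix with signed binomial entries. -/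
def basisP (n : ℕ) : Matrix (Fin n) (Fin n) ℚ :=
  fun i d => (-1) ^ i.val * (Nat.choose i.val d.val : ℚ)

/-- The upper bidiagonal form. -/
def bidiagB (n : ℕ) : Matrix (Fin n) (Fin n) ℚ :=
  fun e d => (if e.val = d.val then (d.val : ℚ) * (n - d.val) else 0) +
    (if e.val + 1 = d.val then -((n : ℚ) - d.val) * (n - d.val + 1) else 0)

lemma choose_absorb (i d : ℕ) :
    ((d : ℚ) + 1) * (Nat.choose i (d + 1) : ℚ) = ((i : ℚ) - d) * (Nat.choose i d : ℚ) := by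
  rcases le_or_gt d i with h | h
  · have := Nat.choose_succ_right_eq i d
    have h2 : ((Nat.choose i (d + 1) * (d + 1) : ℕ) : ℚ) = ((Nat.choose i d * (i - d) : ℕ) : ℚ) := by
      rw [this]
    push_cast [Nat.cast_sub h] at h2
    linarith
  · rw [Nat.choose_eq_zero_of_lt h, Nat.choose_eq_zero_of_lt (by omega)]; simp

/-- Sum of three Kronecker deltas over `range n`. -/
lemma sum_tri (n i : ℕ) (hi : i < n) (a b c : ℚ) (f : ℕ → ℚ) (hc : i + 1 = n → c = 0) :
    ∑ j ∈ Finset.range n, (if i = j then a else if i = j + 1 then b else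
      if j = i + 1 then c else 0) * f j =
      a * f i + (if i = 0 then 0 else b * f (i - 1)) + c * f (i + 1) := by
  have h : ∀ j ∈ Finset.range n, (if i = j then a else if i = j + 1 then b else
      if j = i + 1 then c else 0) * f j = (if i = j then a * f j else 0) +
      (if i = 0 then 0 else if i - 1 = j then b * f j else 0) +
      (if i + 1 = j then c * f j else 0) := by
    intro j _
    split_ifs <;> first | omega | simp
  rw [Finset.sum_congr rfl h, Finset.sum_add_distrib, Finset.sum_add_distrib]
  congr 1
  · congr 1
    · simp [Finset.sum_ite_eq, hi]
    · split_ifs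
      · simp
      · rw [Finset.sum_ite_eq, if_pos (by simp; omega)]
  · rw [Finset.sum_ite_eq]
    split_ifs with h
    · rfl
    · rw [hc (by simp at h; omega)]; simp

lemma sum_bi (n d : ℕ) (hd : d < n) (a b : ℚ) (f : ℕ → ℚ) :
    ∑ e ∈ Finset.range n, f e * ((if e = d then a else 0) + (if e + 1 = d then b else 0)) =
      f d * a + (if d = 0 then 0 else f (d - 1) * b) := by
  have h : ∀ e ∈ Finset.range n,
      f e * ((if e = d then a else 0) + (if e + 1 = d then b else 0)) =
      (if d = e then f e * a else 0) + (if d = 0 then 0 else if d - 1 = e then f e * b else 0) := by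
    intro j _
    split_ifs <;> first | omega | simp
  rw [Finset.sum_congr rfl h, Finset.sum_add_distrib]
  congr 1
  · simp [Finset.sum_ite_eq, hd]
  · split_ifs
    · simp
    · rw [Finset.sum_ite_eq, if_pos (by simp; omega)]

lemma scalar_id (n i d : ℕ) :
    ((n : ℚ) + 1 - ((i : ℚ) + 1)) * ((n : ℚ) + 1 - 2 * ((i : ℚ) + 1)) *
        ((-1) ^ i * (Nat.choose i d : ℚ)) +
      (if i = 0 then 0 else ((n : ℚ) + 1 - ((i : ℚ) + 1)) * (1 - ((i : ℚ) + 1)) *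
        ((-1) ^ (i - 1) * (Nat.choose (i - 1) d : ℚ))) +
      ((n : ℚ) + 1 - ((i : ℚ) + 1)) * ((n : ℚ) - ((i : ℚ) + 1)) *
        ((-1) ^ (i + 1) * (Nat.choose (i + 1) d : ℚ)) =
    (-1) ^ i * (Nat.choose i d : ℚ) * ((d : ℚ) * (n - d)) +
      (if d = 0 then 0 else (-1) ^ i * (Nat.choose i (d - 1) : ℚ) *
        (-((n : ℚ) - d) * (n - d + 1))) := by
  rcases d with _ | d
  · rcases i with _ | i
    · simp; ring
    · simp [pow_succ]; ring
  · have h1 := choose_absorb i d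
    rcases i with _ | i
    · rcases d with _ | d
      · simp; ring
      · simp [Nat.choose_eq_zero_of_lt (show 1 < d + 1 + 1 by omega)]
    · have h2 := choose_absorb i d
      have h3 : ((i + 1 : ℕ) : ℚ) * (Nat.choose i d : ℚ) =
          (Nat.choose (i + 1) (d + 1) : ℚ) * ((d + 1 : ℕ) : ℚ) := by
        exact_mod_cast Nat.add_one_mul_choose_eq i d
      have h4 : (Nat.choose (i + 1) (d + 1) : ℚ) = Nat.choose i d + Nat.choose i (d + 1) := by
        exact_mod_cast Nat.choose_succ_succ i d
      have h5 : (Nat.choose (i + 1 + 1) (d + 1) : ℚ) =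
          Nat.choose (i + 1) d + Nat.choose (i + 1) (d + 1) := by
        exact_mod_cast Nat.choose_succ_succ (i + 1) d
      simp only [Nat.add_sub_cancel, if_neg (Nat.succ_ne_zero _), h5, pow_succ]
      push_cast at *
      have e : (Nat.choose i (d + 1) : ℚ) = Nat.choose (i + 1) (d + 1) - Nat.choose i d := by
        linarith
      rw [e]
      generalize (Nat.choose (i + 1) (d + 1) : ℚ) = x at *
      generalize (Nat.choose (i + 1) d : ℚ) = y at *
      generalize (Nat.choose i d : ℚ) = z at *
      generalize ((-1 : ℚ)) ^ i = s at *
      generalize (i : ℚ) = i at *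
      generalize (d : ℚ) = d at *
      generalize (n : ℚ) = n at *
      -- h1 : (d+1) x = (i+1-d) y, h3 : (i+1) z = x (d+1)
      linear_combination s * (n - i - 1) * h3 + s * (2 * n - i - d - 2) * h1

lemma basisP_det (n : ℕ) : IsUnit (basisP n).det := by
  rw [Matrix.det_of_isLowerTriangular]
  · rw [isUnit_iff_ne_zero, Finset.prod_ne_zero_iff]
    intro i _
    simp [basisP]
  · intro i j hij
    have : i.val < j.val := hij
    simp [basisP, Nat.choose_eq_zero_of_lt this]

/-- The characteristic polynomial of the tridiagonal matrix `C̃`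
equals `∏_{i=1}^n (X - i(n-i))`; equivalently, for every rational `t`,
`det (t • I - C̃) = ∏_{i=1}^n (t - i(n-i))`. -/
theorem stmt_2 (n : ℕ) (hn : 0 < n)
    (Ct : Matrix (Fin n) (Fin n) ℚ)
    (hCt : ∀ i j : Fin n, Ct i j =
      if i.val = j.val then
        ((n : ℚ) + 1 - ((i.val : ℚ) + 1)) * ((n : ℚ) + 1 - 2 * ((i.val : ℚ) + 1))
      else if i.val = j.val + 1 then
        ((n : ℚ) + 1 - ((i.val : ℚ) + 1)) * (1 - ((i.val : ℚ) + 1))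
      else if j.val = i.val + 1 then
        ((n : ℚ) + 1 - ((i.val : ℚ) + 1)) * ((n : ℚ) - ((i.val : ℚ) + 1))
      else 0) :
    Ct.charpoly =
      ∏ i : Fin n, (X - C (((i.val : ℚ) + 1) * ((n : ℚ) - ((i.val : ℚ) + 1)))) ∧
    ∀ t : ℚ,
      (t • (1 : Matrix (Fin n) (Fin n) ℚ) - Ct).det =
        ∏ i : Fin n, (t - ((i.val : ℚ) + 1) * ((n : ℚ) - ((i.val : ℚ) + 1))) := by
  have hmul : Ct * basisP n = basisP n * bidiagB n := by
    ext i d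
    rw [Matrix.mul_apply, Matrix.mul_apply]
    simp only [hCt, basisP, bidiagB]
    have hL := sum_tri n i.val i.isLt
      (((n : ℚ) + 1 - ((i.val : ℚ) + 1)) * ((n : ℚ) + 1 - 2 * ((i.val : ℚ) + 1)))
      (((n : ℚ) + 1 - ((i.val : ℚ) + 1)) * (1 - ((i.val : ℚ) + 1)))
      (((n : ℚ) + 1 - ((i.val : ℚ) + 1)) * ((n : ℚ) - ((i.val : ℚ) + 1)))
      (fun j => (-1) ^ j * (Nat.choose j d.val : ℚ))
      (by intro h
          have : ((i.val : ℚ) + 1) = n := by exact_mod_cast h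
          rw [this]; ring)
    have hR := sum_bi n d.val d.isLt ((d.val : ℚ) * (n - d.val))
      (-((n : ℚ) - d.val) * (n - d.val + 1)) (fun e => (-1) ^ i.val * (Nat.choose i.val e : ℚ))
    rw [Finset.sum_range] at hL hR
    rw [hL, hR]
    exact scalar_id n i.val d.val
  have hP := basisP_det n
  have hcp : Ct.charpoly = (bidiagB n).charpoly := by
    have hC : Ct = basisP n * bidiagB n * (basisP n)⁻¹ := by
      rw [← hmul, Matrix.mul_nonsing_inv_cancel_right _ _ hP]
    rw [hC, Matrix.charpoly_mul_comm, ← Matrix.mul_assoc, Matrix.nonsing_inv_mul _ hP,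
      Matrix.one_mul]
  have hB : (bidiagB n).charpoly =
      ∏ i : Fin n, (X - C ((i.val : ℚ) * ((n : ℚ) - (i.val : ℚ)))) := by
    rw [Matrix.charpoly_of_isUpperTriangular]
    · simp [bidiagB]
    · intro i j hij
      have : j.val < i.val := hij
      simp only [bidiagB]
      rw [if_neg (by omega), if_neg (by omega), add_zero]
  have hshift : ∏ i : Fin n, (X - C ((i.val : ℚ) * ((n : ℚ) - (i.val : ℚ)))) =
      ∏ i : Fin n, (X - C (((i.val : ℚ) + 1) * ((n : ℚ) - ((i.val : ℚ) + 1)))) := by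
    rw [← Finset.prod_range (fun i : ℕ => (X - C ((i : ℚ) * ((n : ℚ) - (i : ℚ))))),
      ← Finset.prod_range (fun i : ℕ => (X - C (((i : ℚ) + 1) * ((n : ℚ) - ((i : ℚ) + 1)))))]
    obtain ⟨m, rfl⟩ : ∃ m, n = m + 1 := ⟨n - 1, by omega⟩
    rw [Finset.prod_range_succ', Finset.prod_range_succ]
    push_cast
    simp
  have hmain := hcp.trans (hB.trans hshift)
  refine ⟨hmain, fun t => ?_⟩
  have := congrArg (Polynomial.eval t) hmain
  rw [Matrix.eval_charpoly, Polynomial.eval_prod] at this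
  rw [Matrix.smul_one_eq_diagonal]
  simpa using this
end

section
/- Let n be a positive integer and r a rational parameter. Suppose real (or rational) sequences a_i^{(t)} for 1 ≤ t ≤ n−1 and b_i are given such that b_i = 0 whenever i ≤ 1 or i > n, and a_i^{(t)} = 0 whenever i + t > n or i ≤ 0. Assume that for every 0 ≤ k ≤ n−2 there is a constant λ(k) such that for every 1 ≤ i ≤ n−k: b_{i+1} − b_i + Σ_{t=1}^{n−1} Σ_{l=0}^{t−1} (−1)^{l+t} C(t−l+k, t−1) C(t−1, l) a_{i+1−l+k}^{(t)} − Σ_{t=1}^{n−1} Σ_{l=0}^{t−1} (−1)^{l+t} C(t−1−l+k, t−1) C(t−1, l) a_{i−l+k}^{(t)} = λ(k). Let A be the n×n matrix with A_{i,i} = r + b_i + Σ_{t=1}^{n−1} (−1)^{t−1} a_i^{(t)}, A_{i,j} = b_i if i = j+1, A_{i,j} = a_i^{(t)} if i = j−t for some 1 ≤ t ≤ n−1, and A_{i,j} = 0 otherwise, and let U be the n×n matrix with entries U_{i,j} = C(n−i, n−j). Then U · A · U⁻¹ is the lower bidiagonal matrix with (i,i)-entry r + Σ_{k=0}^{n−i−1}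 λ(k), (i,i−1)-entry b_i, and all other entries 0. -/
/-- alternating convolution -/
def altD (T q d : ℕ) : ℚ :=
  ∑ l ∈ Finset.range (q+1), (-1:ℚ)^l * (T.choose l : ℚ) * ((q-l+d).choose d : ℚ)

lemma altD_rec (T q d : ℕ) : altD (T+1) (q+1) d = altD T (q+1) d - altD T q d := by
  unfold altD
  rw [Finset.sum_range_succ' _ (q+1), Finset.sum_range_succ' _ (q+1)]
  simp only [Nat.choose_succ_succ, Nat.cast_add, Nat.add_sub_add_right]
  simp only [mul_add, add_mul, Finset.sum_add_distrib, pow_succ]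
  simp
  ring

lemma altD_zero (T d : ℕ) : altD T 0 d = 1 := by simp [altD]

lemma altD_T0 (q d : ℕ) : altD 0 q d = ((q+d).choose q : ℚ) := by
  unfold altD
  rw [Finset.sum_eq_single 0]
  · simp [Nat.choose_symm_add.symm]
  · intro l _ hl
    obtain ⟨l, rfl⟩ := Nat.exists_eq_succ_of_ne_zero hl
    simp
  · simp

lemma altD_one (T q d : ℕ) (h : T ≤ q + d) : altD T q d = ((q+d-T).choose q : ℚ) := by
  induction T generalizing q with
  | zero => simpa using altD_T0 q d
  | succ T ih =>
    cases q with
    | zero => simp [altD_zero]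
    | succ q =>
      rw [altD_rec, ih _ (by omega), ih _ (by omega)]
      have : q + 1 + d - T = (q + 1 + d - (T+1)) + 1 := by omega
      rw [this, Nat.choose_succ_succ]
      have : q + d - T = q + 1 + d - (T+1) := by omega
      rw [this]; push_cast; ring

lemma altD_two (c q d : ℕ) : altD (c+d+1) q d = (-1)^q * (c.choose q : ℚ) := by
  induction c generalizing q with
  | zero =>
    cases q with
    | zero => simp [altD_zero]
    | succ q =>
      rw [altD_one _ _ _ (by omega)]
      have : q + 1 + d - (0 + d + 1) = q := by omega
      rw [this]; simp
  | succ c ih =>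
    cases q with
    | zero => simp [altD_zero]
    | succ q =>
      have : c + 1 + d + 1 = (c + d + 1) + 1 := by ring
      rw [this, altD_rec, ih, ih, Nat.choose_succ_succ]; push_cast; ring

/-- Abel summation. -/
lemma abel_w (K d : ℕ) (h : ℕ → ℚ) :
    ∑ k ∈ Finset.range K, ((K-1-k+(d+1)).choose (d+1) : ℚ) * (h (k+1) - h k)
     = ∑ k ∈ Finset.range (K+1), ((K-k+d).choose d : ℚ) * h k
       - ((K+(d+1)).choose (d+1) : ℚ) * h 0 := by
  have h1 : ∑ k ∈ Finset.range K, ((K-1-k+(d+1)).choose (d+1) : ℚ) * h (k+1) =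
     ∑ k ∈ Finset.range (K+1), ((K-k+(d+1)).choose (d+1) : ℚ) * h k
       - ((K+(d+1)).choose (d+1) : ℚ) * h 0 := by
    rw [Finset.sum_range_succ' _ K]
    simp [Nat.sub_sub, add_comm]
  have h2 : ∑ k ∈ Finset.range (K+1), ((K-k+(d+1)).choose (d+1) : ℚ) * h k =
     ∑ k ∈ Finset.range (K+1), ((K-k+d).choose d : ℚ) * h k +
     ∑ k ∈ Finset.range K, ((K-1-k+(d+1)).choose (d+1) : ℚ) * h k := by
    rw [Finset.sum_range_succ, Finset.sum_range_succ, add_right_comm, ← Finset.sum_add_distrib]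
    simp only [Nat.sub_self, zero_add, Nat.choose_self]
    congr 1
    apply Finset.sum_congr rfl
    intro k hk
    have hk := Finset.mem_range.1 hk
    rw [← add_assoc, Nat.choose_succ_succ]
    have : K - 1 - k + (d+1) = K - k + d := by omega
    rw [this]; push_cast; ring
  simp only [mul_sub, Finset.sum_sub_distrib]
  linarith

lemma final_sum (c t M e : ℕ) :
    ∑ s ∈ Finset.range (e+1), (-1:ℚ)^s * ((c+t+1).choose s : ℚ) * ((e-s+t).choose t : ℚ)
      * ((M+s).choose c : ℚ)
     = (-1)^e * ((M+e+t+1).choose e : ℚ) * (if e ≤ c then (M.choose (c-e) : ℚ) else 0) := by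
  have hV : ∀ s, ((M+s).choose c : ℚ) =
      ∑ j ∈ Finset.range (c+1), (s.choose j : ℚ) * (M.choose (c-j) : ℚ) := by
    intro s
    rw [add_comm, Nat.add_choose_eq, Finset.Nat.sum_antidiagonal_eq_sum_range_succ_mk]
    push_cast; rfl
  have hin : ∀ j ∈ Finset.range (c+1), ∑ s ∈ Finset.range (e+1), (-1:ℚ)^s * ((c+t+1).choose s : ℚ) *
      ((e-s+t).choose t : ℚ) * (s.choose j : ℚ) =
      if j ≤ e then ((c+t+1).choose j : ℚ) * ((-1)^e * ((c-j).choose (e-j) : ℚ)) else 0 := by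
    intro j hj
    have hj : j ≤ c := by have := Finset.mem_range.1 hj; omega
    split_ifs with hje
    · obtain ⟨q, rfl⟩ := Nat.exists_eq_add_of_le hje
      obtain ⟨c, rfl⟩ := Nat.exists_eq_add_of_le hj
      rw [add_assoc j q 1, Finset.sum_range_add, Finset.sum_eq_zero, zero_add]
      · have := altD_two c q t
        unfold altD at this
        have h3 : ∀ x ∈ Finset.range (q+1), (-1:ℚ)^(j+x) * ((j+c+t+1).choose (j+x) : ℚ) *
          ((j+q-(j+x)+t).choose t : ℚ) * ((j+x).choose j : ℚ) =
          (-1)^j * ((j+c+t+1).choose j : ℚ) * ((-1:ℚ)^x * ((c+t+1).choose x : ℚ) * ((q-x+t).choose t : ℚ)) := by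
          intro x _
          have h4 : (j+c+t+1).choose (j+x) * (j+x).choose j = (j+c+t+1).choose j * (c+t+1).choose x := by
            by_cases hx : j + x ≤ j+c+t+1
            · rw [Nat.choose_mul (by omega)]
              congr 2 <;> omega
            · rw [Nat.choose_eq_zero_of_lt (by omega), Nat.choose_eq_zero_of_lt (show c+t+1 < x by omega)]; simp
          have h5 : ((j+c+t+1).choose (j+x) : ℚ) * ((j+x).choose j : ℚ) = (j+c+t+1).choose j * (c+t+1).choose x := by
            exact_mod_cast h4
          have h6 : j + q - (j+x) = q - x := by omega
          rw [h6, pow_add]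
          linear_combination (-1:ℚ)^j * (-1)^x * ((q-x+t).choose t : ℚ) * h5
        rw [Finset.sum_congr rfl h3, ← Finset.mul_sum, this]
        simp only [Nat.add_sub_cancel_left, pow_add]; ring
      · intro x hx
        have := Finset.mem_range.1 hx
        rw [Nat.choose_eq_zero_of_lt this]; simp
    · apply Finset.sum_eq_zero
      intro s hs
      have := Finset.mem_range.1 hs
      rw [Nat.choose_eq_zero_of_lt (show s < j by omega)]; simp
  have step : ∑ s ∈ Finset.range (e+1), (-1:ℚ)^s * ((c+t+1).choose s : ℚ) * ((e-s+t).choose t : ℚ)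
      * ((M+s).choose c : ℚ) = ∑ j ∈ Finset.range (c+1), (M.choose (c-j) : ℚ) * 
      ∑ s ∈ Finset.range (e+1), (-1:ℚ)^s * ((c+t+1).choose s : ℚ) *
      ((e-s+t).choose t : ℚ) * (s.choose j : ℚ) := by
    simp only [hV, Finset.mul_sum]
    rw [Finset.sum_comm]
    refine Finset.sum_congr rfl fun _ _ => Finset.sum_congr rfl fun _ _ => by ring
  rw [step, Finset.sum_congr rfl (fun j hj => by rw [hin j hj])]
  by_cases hec : e ≤ c
  · rw [if_pos hec]
    have hVd : ((M + e + t + 1).choose e : ℚ) * M.choose (c-e) = 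
      ∑ j ∈ Finset.range (e+1), (M.choose (c-e) : ℚ) * (((c+t+1).choose j : ℚ) * ((M+e-c).choose (e-j) : ℚ)) := by
      by_cases hM : c - e ≤ M
      · have : M + e + t + 1 = (c+t+1) + (M+e-c) := by omega
        rw [this, Nat.add_choose_eq, Finset.Nat.sum_antidiagonal_eq_sum_range_succ_mk, ← Finset.mul_sum]
        push_cast; ring
      · rw [Nat.choose_eq_zero_of_lt (show M < c - e by omega)]; simp
    rw [mul_assoc, hVd]
    have : c + 1 = (e+1) + (c-e) := by omega
    rw [this, Finset.sum_range_add, Finset.sum_eq_zero (s := Finset.range (c-e)), add_zero, Finset.mul_sum]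
    · apply Finset.sum_congr rfl
      intro j hj
      have hj := Finset.mem_range.1 hj
      rw [if_pos (by omega)]
      have : M.choose (c-j) * (c-j).choose (e-j) = M.choose (c-e) * (M+e-c).choose (e-j) := by
        by_cases hM : c - j ≤ M
        · rw [← Nat.choose_symm (show e-j ≤ c-j by omega), show c - j - (e-j) = c-e by omega, Nat.choose_mul (by omega)]
          congr 2 <;> omega
        · rw [Nat.choose_eq_zero_of_lt (by omega)]
          by_cases hM2 : c - e ≤ M
          · rw [Nat.choose_eq_zero_of_lt (show M+e-c < e-j by omega)]; simp
          · rw [Nat.choose_eq_zero_of_lt (show M < c - e by omega)]; simp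
      have : (M.choose (c-j) : ℚ) * (c-j).choose (e-j) = M.choose (c-e) * (M+e-c).choose (e-j) := by exact_mod_cast this
      linear_combination ((c+t+1).choose j : ℚ) * (-1)^e * this
    · intro x _
      rw [if_neg (by omega), mul_zero]
  · rw [if_neg hec, mul_zero]
    apply Finset.sum_eq_zero
    intro j hj
    have hj := Finset.mem_range.1 hj
    rw [if_pos (by omega), Nat.choose_eq_zero_of_lt (show c - j < e - j by omega)]; simp

lemma sum_range_eq' (f : ℕ → ℚ) (a b : ℕ) (h : ∀ s, a ≤ s → f s = 0) (h' : ∀ s, b ≤ s → f s = 0) :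
    ∑ s ∈ Finset.range a, f s = ∑ s ∈ Finset.range b, f s := by
  rcases le_total a b with hab | hab
  · exact Finset.sum_subset (Finset.range_mono hab) (fun x _ hx => h x (by simpa using hx))
  · exact (Finset.sum_subset (Finset.range_mono hab) (fun x _ hx => h' x (by simpa using hx))).symm

/-- the inner sum for fixed `t = T+1` -/
def HH (T k : ℕ) (F : ℕ → ℚ) (s : ℕ) : ℚ :=
  ∑ l ∈ Finset.range (T+1), (-1:ℚ)^l * ((T-l+k).choose T : ℚ) * (T.choose l : ℚ) * F (s+k-l)

lemma HH_delta (T k e s : ℕ) : HH T k (fun q => if q = e then 1 else 0) s =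
    if s ≤ e ∧ e ≤ s + k then (-1:ℚ)^(s+k-e) * ((e-s+T).choose T : ℚ) * (T.choose (s+k-e) : ℚ)
    else 0 := by
  simp only [HH]
  split_ifs with h
  · by_cases hT : s+k-e ≤ T
    · rw [Finset.sum_eq_single (s+k-e)]
      · rw [if_pos (by omega), show T - (s+k-e) + k = e - s + T by omega, mul_one]
      · intro l hl hne
        have hl := Finset.mem_range.1 hl
        by_cases hlk : l ≤ k
        · rw [if_neg (by omega), mul_zero]
        · rw [Nat.choose_eq_zero_of_lt (show T - l + k < T by omega)]; simp
      · intro hh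
        exact absurd (Finset.mem_range.2 (by omega)) hh
    · rw [Nat.choose_eq_zero_of_lt (show T < s+k-e by omega), Nat.cast_zero, mul_zero]
      apply Finset.sum_eq_zero
      intro l hl
      have hl := Finset.mem_range.1 hl
      rw [if_neg (by omega), mul_zero]
  · apply Finset.sum_eq_zero
    intro l hl
    have hl := Finset.mem_range.1 hl
    by_cases hlk : l ≤ k
    · rw [if_neg (by omega), mul_zero]
    · rw [Nat.choose_eq_zero_of_lt (show T - l + k < T by omega)]; simp

lemma HH_delta_sum (T K d e s : ℕ) :
    ∑ k ∈ Finset.range (K+1), ((K-k+d).choose d : ℚ) * HH T k (fun q => if q = e then 1 else 0) s =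
    if s ≤ e ∧ e - s ≤ K then ((e-s+T).choose T : ℚ) * altD T (K-(e-s)) d else 0 := by
  simp only [HH_delta]
  split_ifs with h
  · rw [show K + 1 = (e-s) + (K-(e-s)+1) by omega, Finset.sum_range_add, Finset.sum_eq_zero, zero_add]
    · unfold altD
      rw [Finset.mul_sum]
      apply Finset.sum_congr rfl
      intro x _
      rw [if_pos (by omega), show s + (e-s+x) - e = x by omega, show K - (e-s+x) = K-(e-s)-x by omega]
      ring
    · intro x hx
      have hx := Finset.mem_range.1 hx
      rw [if_neg (by omega), mul_zero]
  · apply Finset.sum_eq_zero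
    intro k hk
    have hk := Finset.mem_range.1 hk
    rw [if_neg (by omega), mul_zero]

lemma coeff_main (T K d e : ℕ) (h : e + T ≤ K + d) :
    ∑ s ∈ Finset.range (d+1+1), (-1:ℚ)^(d+1+s) * ((d+1).choose s : ℚ) *
      (if s ≤ e ∧ e - s ≤ K then ((e-s+T).choose T : ℚ) * altD T (K-(e-s)) d else 0)
     = (-1)^(e+d+1) * ((K+d+1).choose e : ℚ) * ((K+d-e-T).choose K : ℚ) := by
  rw [sum_range_eq' _ _ (e+1)]
  rotate_left
  · intro s hs
    rw [Nat.choose_eq_zero_of_lt (by omega)]; simp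
  · intro s hs
    rw [if_neg (by omega), mul_zero]
  have h1 : ∀ s ∈ Finset.range (e+1), (-1:ℚ)^(d+1+s) * ((d+1).choose s : ℚ) *
      (if s ≤ e ∧ e - s ≤ K then ((e-s+T).choose T : ℚ) * altD T (K-(e-s)) d else 0) =
      (-1:ℚ)^(d+1+s) * ((d+1).choose s : ℚ) * ((e-s+T).choose T : ℚ) *
      (if T ≤ d then ((K+d-e-T+s).choose (d-T) : ℚ) else 0) := by
    intro s hs
    have hs := Finset.mem_range.1 hs
    by_cases hK : e - s ≤ K
    · rw [if_pos ⟨by omega, hK⟩, altD_one _ _ _ (by omega)]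
      split_ifs with hT
      · have : (K - (e-s) + d - T).choose (K-(e-s)) = (K+d-e-T+s).choose (d-T) := by
          rw [← Nat.choose_symm (by omega)]
          congr 1 <;> omega
        rw [this]; ring
      · rw [Nat.choose_eq_zero_of_lt (show K - (e-s) + d - T < K - (e-s) by omega)]; simp
    · rw [if_neg (by omega)]
      split_ifs with hT
      · rw [Nat.choose_eq_zero_of_lt (show K+d-e-T+s < d - T by omega)]; simp
      · simp
  rw [Finset.sum_congr rfl h1]
  by_cases hT : T ≤ d
  · obtain ⟨c, rfl⟩ := Nat.exists_eq_add_of_le hT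
    simp only [if_pos hT]
    have := final_sum c T (K+(T+c)-e-T) e
    have h2 : ∀ s ∈ Finset.range (e+1), (-1:ℚ)^(T+c+1+s) * ((T+c+1).choose s : ℚ) * ((e-s+T).choose T : ℚ) *
      ((K+(T+c)-e-T+s).choose (T+c-T) : ℚ) = (-1:ℚ)^(T+c+1) * ((-1:ℚ)^s * ((c+T+1).choose s : ℚ) * ((e-s+T).choose T : ℚ)
      * ((K+(T+c)-e-T+s).choose c : ℚ)) := by
      intro s _
      rw [Nat.add_sub_cancel_left, add_comm c T, pow_add]; ring
    rw [Finset.sum_congr rfl h2, ← Finset.mul_sum, this]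
    have h3 : (if e ≤ c then ((K+(T+c)-e-T).choose (c-e) : ℚ) else 0) = ((K+(T+c)-e-T).choose K : ℚ) := by
      split_ifs with hec
      · congr 1
        rw [← Nat.choose_symm (by omega)]
        congr 1; omega
      · rw [Nat.choose_eq_zero_of_lt (by omega)]; simp
    rw [h3, show K+(T+c)-e-T+e+T+1 = K+(T+c)+1 by omega]
    ring
  · simp only [if_neg hT]
    rw [Nat.choose_eq_zero_of_lt (show K+d-e-T < K by omega)]; simp

/-- the weighted sum of iterated differences -/
def WW (T K d : ℕ) (F : ℕ → ℚ) : ℚ :=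
  ∑ k ∈ Finset.range K, ((K-1-k+d).choose d : ℚ) *
    ∑ s ∈ Finset.range (d+1), (-1:ℚ)^(d+s) * (d.choose s : ℚ) * (HH T (k+1) F s - HH T k F s)

lemma WW_delta (T K d e : ℕ) (h : e + T ≤ K + d) :
    WW T K (d+1) (fun q => if q = e then 1 else 0) =
     (-1:ℚ)^(e+(d+1)+1) * ((K+(d+1)).choose e : ℚ) *
      (((K+(d+1)-e).choose K : ℚ) - ((K+(d+1)-e-(T+1)).choose K : ℚ)) := by
  have hab := abel_w K d (fun k => ∑ s ∈ Finset.range (d+1+1), (-1:ℚ)^(d+1+s) * ((d+1).choose s : ℚ) *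
    HH T k (fun q => if q = e then 1 else 0) s)
  simp only [← Finset.sum_sub_distrib, ← mul_sub] at hab
  unfold WW
  rw [hab]
  have h1 : ∑ k ∈ Finset.range (K+1), ((K-k+d).choose d : ℚ) *
     ∑ s ∈ Finset.range (d+1+1), (-1:ℚ)^(d+1+s) * ((d+1).choose s : ℚ) *
      HH T k (fun q => if q = e then 1 else 0) s =
      (-1)^(e+d+1) * ((K+d+1).choose e : ℚ) * ((K+d-e-T).choose K : ℚ) := by
    rw [← coeff_main T K d e h]
    simp only [← HH_delta_sum, Finset.mul_sum]
    rw [Finset.sum_comm]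
    refine Finset.sum_congr rfl fun _ _ => Finset.sum_congr rfl fun _ _ => by ring
  have h0 : ∑ s ∈ Finset.range (d+1+1), (-1:ℚ)^(d+1+s) * ((d+1).choose s : ℚ) *
      HH T 0 (fun q => if q = e then 1 else 0) s = (-1)^(d+1+e) * ((d+1).choose e : ℚ) := by
    by_cases hed : e ≤ d + 1
    · rw [Finset.sum_eq_single e]
      · simp [HH_delta]
      · intro s _ hs
        rw [HH_delta, if_neg (by omega), mul_zero]
      · intro hh
        exact absurd (Finset.mem_range.2 (by omega)) hh
    · rw [Nat.choose_eq_zero_of_lt (show d+1 < e by omega), Nat.cast_zero, mul_zero]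
      apply Finset.sum_eq_zero
      intro s hs
      have hs := Finset.mem_range.1 hs
      rw [HH_delta, if_neg (by omega), mul_zero]
  rw [h1, h0]
  have h2 : (K+(d+1)).choose (d+1) * (d+1).choose e = (K+(d+1)).choose e * (K+(d+1)-e).choose K := by
    by_cases hed : e ≤ d+1
    · rw [Nat.choose_mul hed]
      congr 1
      rw [← Nat.choose_symm (by omega)]
      congr 1; omega
    · rw [Nat.choose_eq_zero_of_lt (show d+1 < e by omega), Nat.choose_eq_zero_of_lt (show K + (d+1) - e < K by omega)]; simp
  have h2 : ((K+(d+1)).choose (d+1) : ℚ) * (d+1).choose e = (K+(d+1)).choose e * (K+(d+1)-e).choose K := by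
    exact_mod_cast h2
  rw [show K+d-e-T = K+(d+1)-e-(T+1) by omega, show K+d+1 = K+(d+1) by ring]
  simp only [pow_add, pow_one]
  linear_combination (-1:ℚ)^d * (-1)^e * h2

lemma WW_sum (T K d : ℕ) (F : ℕ → ℚ) (N : ℕ) (hF : ∀ q, N < q → F q = 0) :
    WW T K d F = ∑ e ∈ Finset.range (N+1), F e * WW T K d (fun q => if q = e then 1 else 0) := by
  have hF' : ∀ q, F q = ∑ e ∈ Finset.range (N+1), F e * (if q = e then 1 else 0) := by
    intro q
    by_cases hq : q ≤ N
    · rw [Finset.sum_eq_single q]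
      · simp
      · intro x _ hx
        rw [if_neg (Ne.symm hx), mul_zero]
      · intro hh
        exact absurd (Finset.mem_range.2 (by omega)) hh
    · rw [hF q (by omega), Finset.sum_eq_zero]
      intro x hx
      have := Finset.mem_range.1 hx
      rw [if_neg (by omega), mul_zero]
  have hH : ∀ k s, HH T k F s = ∑ e ∈ Finset.range (N+1), F e * HH T k (fun q => if q = e then 1 else 0) s := by
    intro k s
    unfold HH
    simp only [Finset.mul_sum]
    rw [Finset.sum_comm]
    apply Finset.sum_congr rfl
    intro l _
    rw [hF' (s+k-l), Finset.mul_sum]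
    refine Finset.sum_congr rfl fun _ _ => by ring
  unfold WW
  simp only [hH, ← Finset.sum_sub_distrib, Finset.mul_sum]
  conv_rhs => rw [Finset.sum_comm]
  apply Finset.sum_congr rfl
  intro k _
  rw [Finset.sum_comm]
  refine Finset.sum_congr rfl fun _ _ => Finset.sum_congr rfl fun _ _ => by ring

lemma WW_main (T K d : ℕ) (F : ℕ → ℚ) (hF : ∀ q, K + d < q + (T+1) → F q = 0) :
    WW T K d F = ∑ e ∈ Finset.range (K+d+1), (-1:ℚ)^(e+d+1) * ((K+d).choose e : ℚ) *
      (((K+d-e).choose K : ℚ) - ((K+d-e-(T+1)).choose K : ℚ)) * F e := by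
  cases d with
  | zero =>
    have h1 : WW T K 0 F = HH T K F 0 - HH T 0 F 0 := by
      unfold WW
      simp [Finset.sum_range_sub (fun k => HH T k F 0)]
    have h2 : HH T K F 0 = 0 := by
      unfold HH
      apply Finset.sum_eq_zero
      intro l hl
      have := Finset.mem_range.1 hl
      rw [hF _ (by omega), mul_zero]
    have h3 : HH T 0 F 0 = F 0 := by
      unfold HH
      rw [Finset.sum_eq_single 0]
      · simp
      · intro l hl hne
        have := Finset.mem_range.1 hl
        rw [Nat.choose_eq_zero_of_lt (show T - l + 0 < T by omega)]; simp
      · simp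
    rw [h1, h2, h3, Finset.sum_eq_single 0]
    · by_cases hK : K = 0
      · rw [hF 0 (by omega)]; simp
      · simp [Nat.choose_eq_zero_of_lt (show K - (T+1) < K by omega)]
    · intro e _ he
      by_cases hK : K < e + (T+1)
      · rw [hF e (by omega), mul_zero]
      · rw [Nat.choose_eq_zero_of_lt (show K + 0 - e < K by omega), Nat.choose_eq_zero_of_lt (show K + 0 - e - (T+1) < K by omega)]; simp
    · simp
  | succ d =>
    rw [WW_sum T K (d+1) F (K+(d+1)) (fun q hq => hF q (by omega))]
    apply Finset.sum_congr rfl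
    intro e _
    by_cases he : e + T ≤ K + d
    · rw [WW_delta _ _ _ _ he]; ring
    · rw [hF e (by omega)]; simp

lemma GG (T k s : ℕ) (z : ℤ) (f : ℤ → ℚ) :
    ∑ l ∈ Finset.range (T+1), (-1:ℚ)^(l+(T+1)) * ((T-l+k).choose T : ℚ) * (T.choose l : ℚ) *
      f (z + (s:ℤ) - (l:ℤ) + (k:ℤ)) = (-1:ℚ)^(T+1) * HH T k (fun q => f (z + (q:ℤ))) s := by
  simp only [HH]
  rw [Finset.mul_sum]
  apply Finset.sum_congr rfl
  intro l hl
  have hl := Finset.mem_range.1 hl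
  by_cases hlk : l ≤ k
  · rw [show z + ((s + k - l : ℕ):ℤ) = z + (s:ℤ) - (l:ℤ) + (k:ℤ) by push_cast [show l ≤ s + k by omega]; ring, pow_add]
    ring
  · rw [Nat.choose_eq_zero_of_lt (show T - l + k < T by omega)]; simp

lemma alt_choose (d : ℕ) : ∑ s ∈ Finset.range (d+1), (-1:ℚ)^(d+s) * (d.choose s : ℚ) =
    if d = 0 then 1 else 0 := by
  have := @Int.alternating_sum_range_choose d
  have h : ∑ s ∈ Finset.range (d+1), (-1:ℚ)^s * (d.choose s : ℚ) = if d = 0 then 1 else 0 := by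
    exact_mod_cast this
  simp only [pow_add, mul_assoc]
  rw [← Finset.mul_sum, h]
  split_ifs with hd <;> simp [hd]

lemma diff_succ (d : ℕ) (β : ℕ → ℚ) :
    ∑ s ∈ Finset.range (d+1), (-1:ℚ)^(d+s) * (d.choose s : ℚ) * (β (s+1) - β s) =
    ∑ e ∈ Finset.range (d+2), (-1:ℚ)^(d+1+e) * ((d+1).choose e : ℚ) * β e := by
  rw [Finset.sum_range_succ' _ (d+1)]
  have h1 : ∑ s ∈ Finset.range (d+1), (-1:ℚ)^(d+s) * (d.choose s : ℚ) * β s =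
    ∑ s ∈ Finset.range (d+1), (-1:ℚ)^(d+(s+1)) * (d.choose (s+1) : ℚ) * β (s+1) + (-1:ℚ)^d * β 0 := by
    have := Finset.sum_range_succ' (fun s => (-1:ℚ)^(d+s) * (d.choose s : ℚ) * β s) (d+1)
    rw [Finset.sum_range_succ] at this
    simpa using this
  simp only [mul_sub, Finset.sum_sub_distrib, h1, Nat.choose_succ_succ, Nat.cast_add, mul_add, add_mul,
    Finset.sum_add_distrib]
  simp only [pow_add, pow_one, Nat.choose_zero_right, Nat.cast_one, pow_zero]
  have h2 : ∀ x, (-1:ℚ)^d * (-1) * ((-1)^x * (-1)) = (-1:ℚ)^d * (-1)^x := by intro x; ring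
  have h3 : ∀ x, (-1:ℚ)^d * ((-1)^x * (-1)) = - ((-1:ℚ)^d * (-1)^x) := by intro x; ring
  simp only [h2, h3, neg_mul, Finset.sum_neg_distrib]
  ring

lemma sum_w (K d : ℕ) : ∑ k ∈ Finset.range K, ((K-1-k+d).choose d : ℚ) = ((K+d).choose (d+1) : ℚ) := by
  rw [Finset.sum_range_reflect (fun k => ((k+d).choose d : ℚ))]
  induction K with
  | zero => simp
  | succ K ih =>
    rw [Finset.sum_range_succ, ih, show K+1+d = K+d+1 by ring, Nat.choose_succ_succ]
    push_cast; ring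

/-- the entries of the inverse of `U` -/
def Vf (n p j : ℕ) : ℚ := (-1:ℚ)^(p+j) * ((n-(p+1)).choose (n-(j+1)) : ℚ)

lemma sum_U (n i : ℕ) (hi : i < n) (G : ℕ → ℚ) :
    ∑ m ∈ Finset.range n, ((n-(i+1)).choose (n-(m+1)) : ℚ) * G m =
    ∑ e ∈ Finset.range (n-(i+1)+1), ((n-(i+1)).choose e : ℚ) * G (i+e) := by
  obtain ⟨N, rfl⟩ := Nat.exists_eq_add_of_lt hi
  rw [show i + N + 1 - (i+1) = N by omega, add_assoc i N 1, Finset.sum_range_add, Finset.sum_eq_zero, zero_add]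
  · apply Finset.sum_congr rfl
    intro e he
    have he := Finset.mem_range.1 he
    rw [← Nat.choose_symm (show e ≤ N by omega)]
    rw [show i + (N+1) - (i+e+1) = N - e by omega]
  · intro m hm
    have hm := Finset.mem_range.1 hm
    rw [Nat.choose_eq_zero_of_lt (by omega)]; simp

lemma UV (n i j : ℕ) (hi : i < n) (hj : j < n) :
    ∑ e ∈ Finset.range (n-(i+1)+1), ((n-(i+1)).choose e : ℚ) * Vf n (i+e) j = if i = j then 1 else 0 := by
  by_cases hij : i ≤ j
  · obtain ⟨d, rfl⟩ := Nat.exists_eq_add_of_le hij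
    obtain ⟨K, rfl⟩ := Nat.exists_eq_add_of_lt hj
    rw [show i + d + K + 1 - (i+1) = K + d by omega]
    have h1 : ∀ e ∈ Finset.range (K+d+1), ((K+d).choose e : ℚ) * Vf (i+d+K+1) (i+e) (i+d) =
        ((K+d).choose d : ℚ) * ((-1:ℚ)^(d+e) * (d.choose e : ℚ)) := by
      intro e he
      have he := Finset.mem_range.1 he
      have h2 : (K+d).choose d * d.choose e = (K+d).choose e * (K+d-e).choose K := by
        by_cases hed : e ≤ d
        · rw [Nat.choose_mul hed]
          congr 1
          rw [← Nat.choose_symm (by omega)]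
          congr 1; omega
        · rw [Nat.choose_eq_zero_of_lt (show d < e by omega), Nat.choose_eq_zero_of_lt (show K + d - e < K by omega)]; simp
      have h2 : ((K+d).choose d : ℚ) * d.choose e = (K+d).choose e * (K+d-e).choose K := by
        exact_mod_cast h2
      unfold Vf
      rw [show i+d+K+1-(i+e+1) = K+d-e by omega, show i+d+K+1-(i+d+1) = K by omega,
        show i+e+(i+d) = 2*i + (d+e) by ring, pow_add, pow_mul]
      norm_num
      linear_combination -(-1:ℚ)^(d+e) * h2
    rw [Finset.sum_congr rfl h1, ← Finset.mul_sum, sum_range_eq' _ _ (d+1), alt_choose]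
    · by_cases hd : d = 0 <;> simp [hd]
    · intro s hs
      rw [Nat.choose_eq_zero_of_lt (by omega)]; simp
    · intro s hs
      rw [Nat.choose_eq_zero_of_lt (by omega)]; simp
  · rw [if_neg (by omega)]
    apply Finset.sum_eq_zero
    intro e _
    unfold Vf
    rw [Nat.choose_eq_zero_of_lt (show n - (i+e+1) < n - (j+1) by omega)]; simp

lemma sumIcc (n : ℕ) (f : ℕ → ℚ) : ∑ t ∈ Finset.Icc 1 (n-1), f t = ∑ T ∈ Finset.range (n-1), f (T+1) := by
  have h : Finset.Icc 1 (n-1) = Finset.Ico 1 (n-1+1) := by ext x; simp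
  rw [h, Finset.sum_Ico_eq_sum_range, Nat.add_sub_cancel]
  exact Finset.sum_congr rfl fun T _ => by rw [add_comm]

lemma b_bracket (n m j : ℕ) (hm : m < n) (hj : j < n) (b : ℤ → ℚ) (hb : b 1 = 0) :
    b ((m:ℤ)+1) * (Vf n m j + if m = 0 then 0 else Vf n (m-1) j) =
    b ((m:ℤ)+1) * ((-1:ℚ)^(m+j+1) * if j + 1 < n then ((n-(m+1)).choose (n-(j+2)) : ℚ) else 0) := by
  cases m with
  | zero => simp [hb]
  | succ m =>
    congr 1
    simp only [Vf, Nat.add_sub_cancel, Nat.succ_ne_zero, if_false]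
    rw [show n - (m+1) = n - (m+1+1) + 1 by omega]
    split_ifs with h
    · rw [show n - (j+1) = n - (j+2) + 1 by omega, Nat.choose_succ_succ]
      push_cast; ring
    · rw [show n - (j+1) = 0 by omega]; simp; ring

lemma a_bracket (n m j T : ℕ) :
    (-1:ℚ)^T * Vf n m j + Vf n (m+1+T) j = (-1:ℚ)^(T+1) * ((-1:ℚ)^(m+j+1) *
     (((n-(m+1)).choose (n-(j+1)) : ℚ) - ((n-(m+1)-(T+1)).choose (n-(j+1)) : ℚ))) := by
  unfold Vf
  rw [show n - (m+1+T+1) = n-(m+1)-(T+1) by omega]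
  ring

lemma AV (n m j : ℕ) (hm : m < n) (a : ℕ → ℤ → ℚ) (b : ℤ → ℚ) (r : ℚ)
    (ha : ∀ t : ℕ, 1 ≤ t → t ≤ n - 1 → ∀ i : ℤ,
      ((n : ℤ) < i + t ∨ i ≤ 0) → a t i = 0) :
    ∑ p ∈ Finset.range n, (if m = p then
        r + b ((m : ℤ) + 1)
          + ∑ t ∈ Finset.Icc 1 (n - 1), (-1 : ℚ) ^ (t - 1) * a t ((m : ℤ) + 1)
      else if m = p + 1 then b ((m : ℤ) + 1)
      else if m < p then a (p - m) ((m : ℤ) + 1)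
      else 0) * Vf n p j =
    r * Vf n m j + b ((m:ℤ)+1) * (Vf n m j + if m = 0 then 0 else Vf n (m-1) j) +
    ∑ T ∈ Finset.range (n-1), a (T+1) ((m:ℤ)+1) * ((-1:ℚ)^T * Vf n m j + Vf n (m+1+T) j) := by
  rw [sumIcc]
  set D : ℚ := ∑ T ∈ Finset.range (n-1), (-1:ℚ)^(T+1-1) * a (T+1) ((m:ℤ)+1) with hD
  have h1 : ∀ p, (if m = p then r + b ((m : ℤ) + 1) + D
      else if m = p + 1 then b ((m : ℤ) + 1)
      else if m < p then a (p - m) ((m : ℤ) + 1)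
      else 0) * Vf n p j = (if m = p then (r + b ((m:ℤ)+1) + D) * Vf n p j else 0)
       + (if m = p + 1 then b ((m:ℤ)+1) * Vf n p j else 0)
       + (if m < p then a (p-m) ((m:ℤ)+1) * Vf n p j else 0) := by
    intro p
    split_ifs <;> first | omega | simp
  simp only [h1, Finset.sum_add_distrib]
  have h2 : ∑ p ∈ Finset.range n, (if m = p then (r + b ((m:ℤ)+1) + D) * Vf n p j else 0) =
     (r + b ((m:ℤ)+1) + D) * Vf n m j := by
    rw [Finset.sum_ite_eq]; simp [hm]
  have h3 : ∑ p ∈ Finset.range n, (if m = p + 1 then b ((m:ℤ)+1) * Vf n p j else 0) =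
     b ((m:ℤ)+1) * (if m = 0 then 0 else Vf n (m-1) j) := by
    split_ifs with h0
    · simp [h0]
    · rw [Finset.sum_eq_single (m-1)]
      · rw [if_pos (by omega)]
      · intro p _ hp
        rw [if_neg (by omega)]
      · intro hh
        exact absurd (Finset.mem_range.2 (by omega)) hh
  have h4 : ∑ p ∈ Finset.range n, (if m < p then a (p-m) ((m:ℤ)+1) * Vf n p j else 0) =
     ∑ T ∈ Finset.range (n-1), a (T+1) ((m:ℤ)+1) * Vf n (m+1+T) j := by
    conv_lhs => rw [show n = (m+1) + (n-1-m) by omega]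
    rw [Finset.sum_range_add, Finset.sum_eq_zero, zero_add, show m + 1 + (n-1-m) = n by omega]
    · conv_rhs => rw [show n - 1 = (n-1-m) + m by omega]
      rw [Finset.sum_range_add, Finset.sum_eq_zero (s := Finset.range m), add_zero]
      · apply Finset.sum_congr rfl
        intro T _
        rw [if_pos (by omega), show m + 1 + T - m = T + 1 by omega]
      · intro x hx
        have hx := Finset.mem_range.1 hx
        rw [ha _ (by omega) (by omega) _ (by left; push_cast; omega), zero_mul]
    · intro x hx
      have hx := Finset.mem_range.1 hx
      rw [if_neg (by omega)]
  rw [h2, h3, h4]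
  simp only [mul_add, Finset.sum_add_distrib]
  have h5 : ∑ T ∈ Finset.range (n-1), a (T+1) ((m:ℤ)+1) * ((-1:ℚ)^T * Vf n m j) = D * Vf n m j := by
    rw [hD, Finset.sum_mul]
    refine Finset.sum_congr rfl fun T _ => by rw [Nat.add_sub_cancel]; ring
  rw [h5]; ring

lemma key_upper (n i d K : ℕ) (hn : n = i + d + K + 1)
    (a : ℕ → ℤ → ℚ) (b : ℤ → ℚ) (lam : ℕ → ℚ)
    (ha : ∀ t : ℕ, 1 ≤ t → t ≤ n - 1 → ∀ i : ℤ,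
      ((n : ℤ) < i + t ∨ i ≤ 0) → a t i = 0)
    (hlam : ∀ k : ℕ, k + 2 ≤ n → ∀ i : ℤ, 1 ≤ i → i ≤ (n : ℤ) - (k : ℤ) →
      b (i + 1) - b i
        + ∑ t ∈ Finset.Icc 1 (n - 1), ∑ l ∈ Finset.range t,
            (-1 : ℚ) ^ (l + t) * ((t - l + k).choose (t - 1) : ℚ) *
              ((t - 1).choose l : ℚ) * a t (i + 1 - (l : ℤ) + (k : ℤ))
        - ∑ t ∈ Finset.Icc 1 (n - 1), ∑ l ∈ Finset.range t,
            (-1 : ℚ) ^ (l + t) * ((t - 1 - l + k).choose (t - 1) : ℚ) *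
              ((t - 1).choose l : ℚ) * a t (i - (l : ℤ) + (k : ℤ))
        = lam k) :
    ((K+d).choose (d+1) : ℚ) * (∑ e ∈ Finset.range (d+2), (-1:ℚ)^(d+1+e) * ((d+1).choose e : ℚ) * b ((i:ℤ)+1+(e:ℤ)))
    + ∑ T ∈ Finset.range (n-1), (-1:ℚ)^(T+1) * (∑ e ∈ Finset.range (K+d+1), (-1:ℚ)^(e+d+1) * ((K+d).choose e : ℚ) *
      (((K+d-e).choose K : ℚ) - ((K+d-e-(T+1)).choose K : ℚ)) * a (T+1) ((i:ℤ)+1+(e:ℤ))) =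
    if d = 0 then ∑ k ∈ Finset.range K, lam k else 0 := by
  have hW : ∀ T ∈ Finset.range (n-1), (-1:ℚ)^(T+1) * (∑ e ∈ Finset.range (K+d+1), (-1:ℚ)^(e+d+1) * ((K+d).choose e : ℚ) *
      (((K+d-e).choose K : ℚ) - ((K+d-e-(T+1)).choose K : ℚ)) * a (T+1) ((i:ℤ)+1+(e:ℤ))) =
      (-1:ℚ)^(T+1) * WW T K d (fun q => a (T+1) ((i:ℤ)+1+(q:ℤ))) := by
    intro T hT
    have hT := Finset.mem_range.1 hT
    rw [WW_main]
    intro q hq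
    exact ha _ (by omega) (by omega) _ (by left; push_cast; omega)
  rw [Finset.sum_congr rfl hW]
  have hl : ∀ k ∈ Finset.range K, ∀ s ∈ Finset.range (d+1), lam k =
      (b ((i:ℤ)+1+((s+1:ℕ):ℤ)) - b ((i:ℤ)+1+(s:ℤ))) + ∑ T ∈ Finset.range (n-1), (-1:ℚ)^(T+1) *
        (HH T (k+1) (fun q => a (T+1) ((i:ℤ)+1+(q:ℤ))) s - HH T k (fun q => a (T+1) ((i:ℤ)+1+(q:ℤ))) s) := by
    intro k hk s hs
    have hk := Finset.mem_range.1 hk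
    have hs := Finset.mem_range.1 hs
    rw [← hlam k (by omega) ((i:ℤ)+1+(s:ℤ)) (by omega) (by omega), sumIcc, sumIcc]
    simp only [mul_sub, Finset.sum_sub_distrib, ← GG, Nat.add_sub_cancel]
    have h7 : ∀ T ∈ Finset.range (n-1), ∑ l ∈ Finset.range (T+1), (-1:ℚ)^(l+(T+1)) * ((T+1-l+k).choose T : ℚ) * (T.choose l : ℚ) *
       a (T+1) ((i:ℤ)+1+(s:ℤ)+1-(l:ℤ)+(k:ℤ)) = ∑ l ∈ Finset.range (T+1), (-1:ℚ)^(l+(T+1)) * ((T-l+(k+1)).choose T : ℚ) * (T.choose l : ℚ) *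
       a (T+1) ((i:ℤ)+1+(s:ℤ)-(l:ℤ)+((k+1:ℕ):ℤ)) := by
      intro T _
      apply Finset.sum_congr rfl
      intro l hl
      have hl := Finset.mem_range.1 hl
      rw [show T + 1 - l + k = T - l + (k+1) by omega,
        show (i:ℤ)+1+(s:ℤ)+1-(l:ℤ)+(k:ℤ) = (i:ℤ)+1+(s:ℤ)-(l:ℤ)+((k+1:ℕ):ℤ) by push_cast; ring]
    rw [Finset.sum_congr rfl h7, show (i:ℤ)+1+(s:ℤ)+1 = (i:ℤ)+1+((s+1:ℕ):ℤ) by push_cast; ring]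
    ring
  have hR : (if d = 0 then ∑ k ∈ Finset.range K, lam k else 0) =
      ∑ k ∈ Finset.range K, ((K-1-k+d).choose d : ℚ) *
        ∑ s ∈ Finset.range (d+1), (-1:ℚ)^(d+s) * (d.choose s : ℚ) * lam k := by
    simp only [← Finset.sum_mul, alt_choose]
    split_ifs with hd
    · simp [hd]
    · simp
  rw [hR]
  have hR2 := Finset.sum_congr (rfl : Finset.range K = Finset.range K) (fun k hk =>
    congrArg (fun x => ((K-1-k+d).choose d : ℚ) * x)
     (Finset.sum_congr (rfl : Finset.range (d+1) = Finset.range (d+1)) (fun s hs =>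
      congrArg (fun x => (-1:ℚ)^(d+s) * (d.choose s : ℚ) * x) (hl k hk s hs))))
  rw [hR2]
  simp only [mul_add (_ * _), Finset.sum_add_distrib, diff_succ d (fun q => b ((i:ℤ)+1+(q:ℤ)))]
  simp only [mul_add (Nat.cast _), Finset.sum_add_distrib, ← Finset.sum_mul, sum_w]
  congr 1
  simp only [WW, Finset.mul_sum]
  rw [Finset.sum_comm]
  apply Finset.sum_congr rfl
  intro k _
  rw [Finset.sum_comm]
  refine Finset.sum_congr rfl fun _ _ => Finset.sum_congr rfl fun _ _ => by ring

lemma entry_final (n i j : ℕ) (hi : i < n) (hj : j < n) (r : ℚ)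
    (a : ℕ → ℤ → ℚ) (b : ℤ → ℚ) (lam : ℕ → ℚ)
    (hb : ∀ i : ℤ, (i ≤ 1 ∨ (n : ℤ) < i) → b i = 0)
    (ha : ∀ t : ℕ, 1 ≤ t → t ≤ n - 1 → ∀ i : ℤ,
      ((n : ℤ) < i + t ∨ i ≤ 0) → a t i = 0)
    (hlam : ∀ k : ℕ, k + 2 ≤ n → ∀ i : ℤ, 1 ≤ i → i ≤ (n : ℤ) - (k : ℤ) →
      b (i + 1) - b i
        + ∑ t ∈ Finset.Icc 1 (n - 1), ∑ l ∈ Finset.range t,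
            (-1 : ℚ) ^ (l + t) * ((t - l + k).choose (t - 1) : ℚ) *
              ((t - 1).choose l : ℚ) * a t (i + 1 - (l : ℤ) + (k : ℤ))
        - ∑ t ∈ Finset.Icc 1 (n - 1), ∑ l ∈ Finset.range t,
            (-1 : ℚ) ^ (l + t) * ((t - 1 - l + k).choose (t - 1) : ℚ) *
              ((t - 1).choose l : ℚ) * a t (i - (l : ℤ) + (k : ℤ))
        = lam k) :
    ∑ e ∈ Finset.range (n-(i+1)+1), ((n-(i+1)).choose e : ℚ) *
    (r * Vf n (i+e) j + b (((i+e:ℕ):ℤ)+1) * (Vf n (i+e) j + if i+e = 0 then 0 else Vf n (i+e-1) j) +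
    ∑ T ∈ Finset.range (n-1), a (T+1) (((i+e:ℕ):ℤ)+1) * ((-1:ℚ)^T * Vf n (i+e) j + Vf n (i+e+1+T) j)) =
      if i = j then r + ∑ k ∈ Finset.range (n - (i + 1)), lam k
      else if i = j + 1 then b ((i : ℤ) + 1)
      else 0 := by
  have h1 : ∀ e ∈ Finset.range (n-(i+1)+1), ((n-(i+1)).choose e : ℚ) *
    (r * Vf n (i+e) j + b (((i+e:ℕ):ℤ)+1) * (Vf n (i+e) j + if i+e = 0 then 0 else Vf n (i+e-1) j) +
    ∑ T ∈ Finset.range (n-1), a (T+1) (((i+e:ℕ):ℤ)+1) * ((-1:ℚ)^T * Vf n (i+e) j + Vf n (i+e+1+T) j)) =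
    r * (((n-(i+1)).choose e : ℚ) * Vf n (i+e) j) +
    ((n-(i+1)).choose e : ℚ) * (b (((i+e:ℕ):ℤ)+1) * ((-1:ℚ)^(i+e+j+1) * if j + 1 < n then ((n-(i+e+1)).choose (n-(j+2)) : ℚ) else 0))
    + ∑ T ∈ Finset.range (n-1), ((n-(i+1)).choose e : ℚ) * (a (T+1) (((i+e:ℕ):ℤ)+1) * ((-1:ℚ)^(T+1) * ((-1:ℚ)^(i+e+j+1) *
     (((n-(i+e+1)).choose (n-(j+1)) : ℚ) - ((n-(i+e+1)-(T+1)).choose (n-(j+1)) : ℚ))))) := by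
    intro e he
    have he := Finset.mem_range.1 he
    rw [b_bracket n (i+e) j (by omega) hj b (hb 1 (by left; norm_num)), ← Finset.mul_sum]
    simp only [a_bracket]
    ring
  rw [Finset.sum_congr rfl h1]
  simp only [Finset.sum_add_distrib]
  rw [← Finset.mul_sum, UV n i j hi hj, Finset.sum_comm]
  by_cases hij : i ≤ j
  · obtain ⟨d, rfl⟩ := Nat.exists_eq_add_of_le hij
    obtain ⟨K, hK⟩ := Nat.exists_eq_add_of_lt hj
    have hkey := key_upper n i d K hK a b lam ha hlam
    have hN : n - (i+1) = K + d := by omega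
    rw [hN]
    have hsg : ∀ e, (-1:ℚ)^(i+e+(i+d)+1) = (-1:ℚ)^(e+d+1) := by
      intro e
      rw [show i+e+(i+d)+1 = 2*i+(e+d+1) by ring, pow_add, pow_mul]; norm_num
    have hcast : ∀ e : ℕ, ((i+e:ℕ):ℤ)+1 = (i:ℤ)+1+(e:ℤ) := by intro e; push_cast; ring
    have ha2 : ∑ T ∈ Finset.range (n-1), ∑ e ∈ Finset.range (K+d+1), ((K+d).choose e : ℚ) * (a (T+1) (((i+e:ℕ):ℤ)+1) * ((-1:ℚ)^(T+1) * ((-1:ℚ)^(i+e+(i+d)+1) *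
     (((n-(i+e+1)).choose (n-(i+d+1)) : ℚ) - ((n-(i+e+1)-(T+1)).choose (n-(i+d+1)) : ℚ))))) =
     ∑ T ∈ Finset.range (n-1), (-1:ℚ)^(T+1) * (∑ e ∈ Finset.range (K+d+1), (-1:ℚ)^(e+d+1) * ((K+d).choose e : ℚ) *
      (((K+d-e).choose K : ℚ) - ((K+d-e-(T+1)).choose K : ℚ)) * a (T+1) ((i:ℤ)+1+(e:ℤ))) := by
      apply Finset.sum_congr rfl
      intro T _
      rw [Finset.mul_sum]
      apply Finset.sum_congr rfl
      intro e _
      rw [hsg, hcast, show n - (i+e+1) = K+d-e by omega, show n-(i+d+1) = K by omega]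
      ring
    have hb2 : ∑ e ∈ Finset.range (K+d+1), ((K+d).choose e : ℚ) * (b (((i+e:ℕ):ℤ)+1) * ((-1:ℚ)^(i+e+(i+d)+1) * if i+d + 1 < n then ((n-(i+e+1)).choose (n-(i+d+2)) : ℚ) else 0)) =
      ((K+d).choose (d+1) : ℚ) * (∑ e ∈ Finset.range (d+2), (-1:ℚ)^(d+1+e) * ((d+1).choose e : ℚ) * b ((i:ℤ)+1+(e:ℤ))) := by
      by_cases hK0 : K = 0
      · subst hK0
        rw [Nat.choose_eq_zero_of_lt (show 0 + d < d + 1 by omega), Nat.cast_zero, zero_mul]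
        apply Finset.sum_eq_zero
        intro e _
        rw [if_neg (by omega)]; simp
      · rw [Finset.mul_sum]
        have h5 : ∀ e ∈ Finset.range (K+d+1), ((K+d).choose e : ℚ) * (b (((i+e:ℕ):ℤ)+1) * ((-1:ℚ)^(i+e+(i+d)+1) * if i+d + 1 < n then ((n-(i+e+1)).choose (n-(i+d+2)) : ℚ) else 0)) =
          ((K+d).choose (d+1) : ℚ) * ((-1:ℚ)^(d+1+e) * ((d+1).choose e : ℚ) * b ((i:ℤ)+1+(e:ℤ))) := by
          intro e he
          have he := Finset.mem_range.1 he
          rw [hsg, hcast, if_pos (by omega), show n - (i+e+1) = K+d-e by omega, show n-(i+d+2) = K-1 by omega]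
          have h2 : (K+d).choose (d+1) * (d+1).choose e = (K+d).choose e * (K+d-e).choose (K-1) := by
            by_cases hed : e ≤ d+1
            · rw [Nat.choose_mul hed]
              congr 1
              rw [← Nat.choose_symm (by omega)]
              congr 1; omega
            · rw [Nat.choose_eq_zero_of_lt (show d+1 < e by omega), Nat.choose_eq_zero_of_lt (show K + d - e < K-1 by omega)]; simp
          have h2 : ((K+d).choose (d+1) : ℚ) * (d+1).choose e = (K+d).choose e * (K+d-e).choose (K-1) := by
            exact_mod_cast h2
          rw [show e + d + 1 = d + 1 + e by ring]
          linear_combination -(-1:ℚ)^(d+1+e) * b ((i:ℤ)+1+(e:ℤ)) * h2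
        rw [Finset.sum_congr rfl h5]
        have hsub : Finset.range (d+2) ⊆ Finset.range (K+d+1) := Finset.range_mono (by omega)
        symm
        apply Finset.sum_subset hsub
        intro e _ he
        have he : d + 2 ≤ e := by simpa using he
        rw [Nat.choose_eq_zero_of_lt (show d+1 < e by omega)]; simp
    rw [ha2, hb2, add_assoc, hkey]
    by_cases hd : d = 0
    · simp [hd]
    · rw [if_neg (by omega), if_neg hd, if_neg (by omega), if_neg (by omega)]; simp
  · rw [if_neg (by omega), if_neg (by omega), mul_zero, zero_add]
    have ha0 : ∑ T ∈ Finset.range (n-1), ∑ e ∈ Finset.range (n-(i+1)+1), ((n-(i+1)).choose e : ℚ) * (a (T+1) (((i+e:ℕ):ℤ)+1) * ((-1:ℚ)^(T+1) * ((-1:ℚ)^(i+e+j+1) *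
     (((n-(i+e+1)).choose (n-(j+1)) : ℚ) - ((n-(i+e+1)-(T+1)).choose (n-(j+1)) : ℚ))))) = 0 := by
      apply Finset.sum_eq_zero
      intro T _
      apply Finset.sum_eq_zero
      intro e _
      rw [Nat.choose_eq_zero_of_lt (show n-(i+e+1) < n-(j+1) by omega), Nat.choose_eq_zero_of_lt (show n-(i+e+1)-(T+1) < n-(j+1) by omega)]
      simp
    rw [ha0, add_zero]
    by_cases hij1 : i = j + 1
    · rw [if_pos hij1, Finset.sum_eq_single 0]
      · subst hij1
        rw [if_pos (by omega), show n - (j+1+0+1) = n - (j+2) by omega, show j+1+0+j+1 = 2*(j+1) by ring, pow_mul]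
        simp
      · intro e he hne
        have he := Finset.mem_range.1 he
        rw [if_pos (by omega), Nat.choose_eq_zero_of_lt (show n-(i+e+1) < n-(j+2) by omega)]; simp
      · simp
    · rw [if_neg hij1]
      apply Finset.sum_eq_zero
      intro e he
      have he := Finset.mem_range.1 he
      rw [if_pos (by omega), Nat.choose_eq_zero_of_lt (show n-(i+e+1) < n-(j+2) by omega)]; simp

/-- The general triangularization theorem. Under the vanishing
conventions on the sequences `a` and `b` and the constancy condition defining
`λ(k)`, conjugating the banded matrix `A` by `U` yields the lower bidiagonal
matrix with diagonal entries `r + Σ_{k=0}^{n-i-1} λ(k)` and subdiagonal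
entries `b_i`. -/
theorem stmt_9 (n : ℕ) (hn : 0 < n) (r : ℚ)
    (a : ℕ → ℤ → ℚ) (b : ℤ → ℚ) (lam : ℕ → ℚ)
    (hb : ∀ i : ℤ, (i ≤ 1 ∨ (n : ℤ) < i) → b i = 0)
    (ha : ∀ t : ℕ, 1 ≤ t → t ≤ n - 1 → ∀ i : ℤ,
      ((n : ℤ) < i + t ∨ i ≤ 0) → a t i = 0)
    (hlam : ∀ k : ℕ, k + 2 ≤ n → ∀ i : ℤ, 1 ≤ i → i ≤ (n : ℤ) - (k : ℤ) →
      b (i + 1) - b i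
        + ∑ t ∈ Finset.Icc 1 (n - 1), ∑ l ∈ Finset.range t,
            (-1 : ℚ) ^ (l + t) * ((t - l + k).choose (t - 1) : ℚ) *
              ((t - 1).choose l : ℚ) * a t (i + 1 - (l : ℤ) + (k : ℤ))
        - ∑ t ∈ Finset.Icc 1 (n - 1), ∑ l ∈ Finset.range t,
            (-1 : ℚ) ^ (l + t) * ((t - 1 - l + k).choose (t - 1) : ℚ) *
              ((t - 1).choose l : ℚ) * a t (i - (l : ℤ) + (k : ℤ))
        = lam k)
    (A U : Matrix (Fin n) (Fin n) ℚ)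
    (hA : ∀ i j : Fin n, A i j =
      if i.val = j.val then
        r + b ((i.val : ℤ) + 1)
          + ∑ t ∈ Finset.Icc 1 (n - 1), (-1 : ℚ) ^ (t - 1) * a t ((i.val : ℤ) + 1)
      else if i.val = j.val + 1 then b ((i.val : ℤ) + 1)
      else if i.val < j.val then a (j.val - i.val) ((i.val : ℤ) + 1)
      else 0)
    (hU : ∀ i j : Fin n, U i j = ((n - (i.val + 1)).choose (n - (j.val + 1)) : ℚ)) :
    U * A * U⁻¹ = fun i j =>
      if i.val = j.val then r + ∑ k ∈ Finset.range (n - (i.val + 1)), lam k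
      else if i.val = j.val + 1 then b ((i.val : ℤ) + 1)
      else 0 := by
  have hUV : U * (Matrix.of fun p j : Fin n => Vf n p.val j.val) = 1 := by
    ext i j
    rw [Matrix.mul_apply, Matrix.one_apply]
    simp only [hU, Matrix.of_apply]
    rw [Fin.sum_univ_eq_sum_range (fun m => ((n-(i.val+1)).choose (n-(m+1)) : ℚ) * Vf n m j.val) n,
      sum_U n i.val i.isLt, UV n i.val j.val i.isLt j.isLt]
    simp only [Fin.ext_iff]
  rw [Matrix.inv_eq_right_inv hUV, Matrix.mul_assoc]
  ext i j
  rw [Matrix.mul_apply]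
  have hAV : ∀ m : Fin n, (A * (Matrix.of fun p j : Fin n => Vf n p.val j.val)) m j =
      r * Vf n m.val j.val + b ((m.val:ℤ)+1) * (Vf n m.val j.val + if m.val = 0 then 0 else Vf n (m.val-1) j.val) +
    ∑ T ∈ Finset.range (n-1), a (T+1) ((m.val:ℤ)+1) * ((-1:ℚ)^T * Vf n m.val j.val + Vf n (m.val+1+T) j.val) := by
    intro m
    rw [← AV n m.val j.val m.isLt a b r ha, Matrix.mul_apply]
    simp only [hA, Matrix.of_apply]
    exact Fin.sum_univ_eq_sum_range (fun p => (if m.val = p then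
        r + b ((m.val : ℤ) + 1)
          + ∑ t ∈ Finset.Icc 1 (n - 1), (-1 : ℚ) ^ (t - 1) * a t ((m.val : ℤ) + 1)
      else if m.val = p + 1 then b ((m.val : ℤ) + 1)
      else if m.val < p then a (p - m.val) ((m.val : ℤ) + 1)
      else 0) * Vf n p j.val) n
  simp only [hAV, hU]
  obtain ⟨i, hi⟩ := i
  obtain ⟨j, hj⟩ := j
  simp only
  rw [Fin.sum_univ_eq_sum_range (fun m => ((n-(i+1)).choose (n-(m+1)) : ℚ) *
    (r * Vf n m j + b ((m:ℤ)+1) * (Vf n m j + if m = 0 then 0 else Vf n (m-1) j) +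
    ∑ T ∈ Finset.range (n-1), a (T+1) ((m:ℤ)+1) * ((-1:ℚ)^T * Vf n m j + Vf n (m+1+T) j))) n,
    sum_U n i hi]
  exact entry_final n i j hi hj r a b lam hb ha hlam
end
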